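/- Let v_1,…,v_m ∈ ℚ^d be nonzero vectors and l_1,…,l_m nonzero rational numbers; set v'_i = v_i / l_i. Let 𝒞 be a finite family of subsets of {1,…,m}, for each σ ∈ 𝒞 let AD(σ) = { a ∈ ℚ^m : a_i = 0 for all i ∉ σ, Σ_i a_i v'_i = 0, Σ_i a_i = 0 }, and let AD = Σ_{σ ∈ 𝒞} AD(σ) ⊆ ℚ^m. Suppose T is a nonempty subset of some σ ∈ 𝒞 and the points { v'_i : i ∈ T } span an affine subspace of ℚ^d of dimension k'. Then the images of the standard basis vectors { e_i : i ∈ T } span a linear subspace of ℚ^m / AD of dimension k' + 1. -/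

import Mathlib

open Set

noncomputable section

/-- A point of `ℝ^d` is a lattice point if all its coordinates are integers. -/
def IsLatticePoint {d : ℕ} (x : Fin d → ℝ) : Prop := ∀ i, ∃ n : ℤ, x i = (n : ℝ)

/-- A (convex) polytope: the convex hull of finitely many points. -/
def IsPolytope {d : ℕ} (P : Set (Fin d → ℝ)) : Prop :=
  ∃ S : Set (Fin d → ℝ), S.Finite ∧ P = convexHull ℝ S

/-- A lattice polytope: the convex hull of finitely many lattice points. -/
def IsLatticePolytope {d : ℕ} (P : Set (Fin d → ℝ)) : Prop :=
  ∃ S : Set (Fin d → ℝ), S.Finite ∧ (∀ x ∈ S, IsLatticePoint x) ∧ P = convexHull ℝ S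

open Classical in
/-- Affine dimension of a set of points, with the convention that the empty set
has affine dimension `-1`. -/
def affDim {d : ℕ} (s : Set (Fin d → ℝ)) : ℤ :=
  if s = ∅ then -1 else (Module.finrank ℝ (affineSpan ℝ s).direction : ℤ)

/-- The vertices of a polytope are its extreme points. -/
def vertexSet {d : ℕ} (P : Set (Fin d → ℝ)) : Set (Fin d → ℝ) :=
  P.extremePoints ℝ

/-- Faces of a polytope, as extreme subsets. -/
def IsFaceOf {d : ℕ} (F P : Set (Fin d → ℝ)) : Prop := IsExtreme ℝ P F

/-- A facet is a face of codimension one. -/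
def IsFacetOf {d : ℕ} (F P : Set (Fin d → ℝ)) : Prop :=
  IsFaceOf F P ∧ affDim F + 1 = affDim P

/-- An edge is a one-dimensional face. -/
def IsEdgeOf {d : ℕ} (e P : Set (Fin d → ℝ)) : Prop :=
  IsFaceOf e P ∧ affDim e = 1

/-- The set of facets of `P`. -/
def facets {d : ℕ} (P : Set (Fin d → ℝ)) : Set (Set (Fin d → ℝ)) :=
  {F | IsFacetOf F P}

/-- Two distinct facets of `P` are adjacent if their intersection is a face of
codimension two. -/
def AdjacentFacets {d : ℕ} (P F G : Set (Fin d → ℝ)) : Prop :=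
  IsFacetOf F P ∧ IsFacetOf G P ∧ F ≠ G ∧ affDim (F ∩ G) + 2 = affDim P

/-- Two distinct vertices are adjacent if the segment joining them is an edge. -/
def AdjacentVertices {d : ℕ} (P : Set (Fin d → ℝ)) (v w : Fin d → ℝ) : Prop :=
  v ≠ w ∧ IsEdgeOf (segment ℝ v w) P

/-- A sequence over a set `𝓕` (of facets) is a list enumerating `𝓕` without repetition. -/
def IsSeqOver {d : ℕ} (𝓕 : Set (Set (Fin d → ℝ))) (L : List (Set (Fin d → ℝ))) : Prop :=
  L.Nodup ∧ ∀ G, G ∈ L ↔ G ∈ 𝓕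

/-- An adjacent (facet) sequence: every term after the first is adjacent to an earlier term. -/
def IsAdjSeq {d : ℕ} (P : Set (Fin d → ℝ)) (L : List (Set (Fin d → ℝ))) : Prop :=
  ∀ i, 0 < i → i < L.length → ∃ j < i, AdjacentFacets P (L.getD j ∅) (L.getD i ∅)

/-- A vertex sequence over a set `V` of vertices. -/
def IsVertSeqOver {d : ℕ} (V : Set (Fin d → ℝ)) (L : List (Fin d → ℝ)) : Prop :=
  L.Nodup ∧ ∀ v, v ∈ L ↔ v ∈ V

/-- An adjacent vertex sequence: every term after the first is adjacent to an earlier term. -/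
def IsAdjVertSeq {d : ℕ} (P : Set (Fin d → ℝ)) (L : List (Fin d → ℝ)) : Prop :=
  ∀ i, 0 < i → i < L.length → ∃ j < i, AdjacentVertices P (L.getD j 0) (L.getD i 0)

/-- `seqS L i` is the union of the vertex sets of the first `i+1` facets of the sequence `L`. -/
def seqS {d : ℕ} (L : List (Set (Fin d → ℝ))) (i : ℕ) : Set (Fin d → ℝ) :=
  ⋃ j ∈ Finset.range (i + 1), vertexSet (L.getD j ∅)

/-- The contribution `a_i` of the `i`-th facet of the sequence `L`, for a `n`-dimensional
polytope: with `w_i` the affine dimension of `S_{i-1} ∩ V(G_i)`, one has `a_i = n - 1 - w_i`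
if `w_i ≥ n - 2`, and `a_i = ∞` otherwise. -/
def seqA {d : ℕ} (n : ℤ) (L : List (Set (Fin d → ℝ))) (i : ℕ) : ℕ∞ :=
  let w : ℤ := affDim (seqS L (i - 1) ∩ vertexSet (L.getD i ∅))
  if n - 2 ≤ w then ((n - 1 - w).toNat : ℕ∞) else ⊤

/-- `ρ_L = Σ_{i=1}^{s-1} a_i` for a facet sequence `L` of a `n`-dimensional polytope. -/
def rhoL {d : ℕ} (n : ℤ) (L : List (Set (Fin d → ℝ))) : ℕ∞ :=
  ∑ i ∈ Finset.Icc 1 (L.length - 1), seqA n L i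

/-- The facet complexity `ρ'(P)`: the minimum of `ρ_L` over all facet sequences over `F(P)`. -/
def facetComplexity {d : ℕ} (P : Set (Fin d → ℝ)) : ℕ∞ :=
  sInf {r | ∃ L, IsSeqOver (facets P) L ∧ r = rhoL (d : ℤ) L}

/-- The space of affine dependences `AD(F)` of a facet `F` of `P`, inside the vector space
with basis indexed by the vertices of `P`. -/
def ADface {d : ℕ} (P F : Set (Fin d → ℝ)) : Set (↥(vertexSet P) →₀ ℚ) :=
  {a | (∀ v : ↥(vertexSet P), (v : Fin d → ℝ) ∉ F → a v = 0) ∧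
    (a.sum fun v c => (c : ℝ) • (v : Fin d → ℝ)) = 0 ∧
    (a.sum fun _ c => c) = 0}

/-- `AD(P)`, the sum of the subspaces `AD(F)` over all facets `F` of `P`. -/
def ADspace {d : ℕ} (P : Set (Fin d → ℝ)) : Submodule ℚ (↥(vertexSet P) →₀ ℚ) :=
  Submodule.span ℚ (⋃ F ∈ facets P, ADface P F)

/-- `ρ(P) = |V(P)| - d - dim_ℚ AD(P)`; by Eikelberg's theorem this is the Picard rank of the
Gorenstein toric Fano variety associated to the spanning fan of a reflexive polytope `P`. -/
def picardRank {d : ℕ} (P : Set (Fin d → ℝ)) : ℤ :=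
  (Nat.card ↥(vertexSet P) : ℤ) - (d : ℤ) - (Module.finrank ℚ (ADspace P) : ℤ)

/-- The polar (dual) polytope `P* = {x : ⟨x, y⟩ ≥ -1 for all y ∈ P}`. -/
def polarDual {d : ℕ} (P : Set (Fin d → ℝ)) : Set (Fin d → ℝ) :=
  {x | ∀ y ∈ P, -1 ≤ ∑ i, x i * y i}

/-- A reflexive polytope: a full-dimensional lattice polytope with `0` in its interior such
that every facet has an integral normal `u_F` with `⟨u_F, x⟩ = -1` on the facet. -/
def IsReflexive {d : ℕ} (P : Set (Fin d → ℝ)) : Prop :=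
  IsLatticePolytope P ∧ affDim P = (d : ℤ) ∧ (0 : Fin d → ℝ) ∈ interior P ∧
    ∀ F ∈ facets P, ∃ u : Fin d → ℤ, ∀ x ∈ F, ∑ i, (u i : ℝ) * x i = -1

/-- A polytope is a simplex if its number of vertices is its affine dimension plus one. -/
def IsSimplex {d : ℕ} (F : Set (Fin d → ℝ)) : Prop :=
  (Nat.card ↥(vertexSet F) : ℤ) = affDim F + 1

/-- A polytope is simplicial if all of its facets are simplices. -/
def IsSimplicial {d : ℕ} (P : Set (Fin d → ℝ)) : Prop :=
  ∀ F ∈ facets P, IsSimplex F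

/-- A reflexive polytope is terminal if its only lattice points are its vertices and the origin. -/
def IsTerminal {d : ℕ} (P : Set (Fin d → ℝ)) : Prop :=
  {x ∈ P | IsLatticePoint x} = vertexSet P ∪ {0}

/-- `HasLevel F v n`: the vertex `v` has level `n` with respect to the facet `F`, i.e.
`⟨u_F, v⟩ = n` for an integral normal `u_F` of `F` with `⟨u_F, ·⟩ = -1` on `F`. -/
def HasLevel {d : ℕ} (F : Set (Fin d → ℝ)) (v : Fin d → ℝ) (n : ℤ) : Prop :=
  ∃ u : Fin d → ℤ, (∀ x ∈ F, ∑ i, (u i : ℝ) * x i = -1) ∧ ∑ i, (u i : ℝ) * v i = (n : ℝ)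

/-- The star `st(F)`: the union of `F` and all the facets adjacent to `F`. -/
def stSet {d : ℕ} (P F : Set (Fin d → ℝ)) : Set (Fin d → ℝ) :=
  F ∪ ⋃ G ∈ {G | AdjacentFacets P F G}, G

/-- A facet `G` is inexpensive with respect to a fixed facet `F` if `G` is adjacent to `F`
or `V(G) ∩ st(F)` spans an affine space of dimension `d - 1`. -/
def InexpensiveFacet {d : ℕ} (P F G : Set (Fin d → ℝ)) : Prop :=
  IsFacetOf G P ∧ (AdjacentFacets P F G ∨ affDim (vertexSet G ∩ stSet P F) = affDim P - 1)

/-- A vertex is expensive with respect to `F` if it lies on no inexpensive facet. -/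
def ExpensiveVertex {d : ℕ} (P F : Set (Fin d → ℝ)) (v : Fin d → ℝ) : Prop :=
  v ∈ vertexSet P ∧ ¬ ∃ G, InexpensiveFacet P F G ∧ v ∈ G

/-- `v` and `w` lie in a common facet of `P`. -/
def InCommonFacet {d : ℕ} (P : Set (Fin d → ℝ)) (v w : Fin d → ℝ) : Prop :=
  ∃ G, IsFacetOf G P ∧ v ∈ G ∧ w ∈ G

/-- Two facets adjacent to `F` are linked if they meet along an edge `conv(x, z)` with
`x` a vertex of `F` and `z` a vertex of level `0`. -/
def Linked {d : ℕ} (P F G₁ G₂ : Set (Fin d → ℝ)) : Prop :=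
  AdjacentFacets P F G₁ ∧ AdjacentFacets P F G₂ ∧ G₁ ≠ G₂ ∧
    ∃ x z, x ∈ vertexSet F ∧ z ∈ vertexSet P ∧ HasLevel F z 0 ∧ G₁ ∩ G₂ = segment ℝ x z

/-- An expensive vertex `v` of level one is attached to a facet `G` at `z` if
`z = v + x ∈ V(G)` for some vertex `x` of `F`. -/
def AttachedAt {d : ℕ} (P F : Set (Fin d → ℝ)) (v : Fin d → ℝ)
    (G : Set (Fin d → ℝ)) (z : Fin d → ℝ) : Prop :=
  ∃ x ∈ vertexSet F, z = v + x ∧ z ∈ vertexSet G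

/-- `coversStar P F L i`: the set `S_i` of the sequence `L` contains all vertices of `st(F)`
as well as all vertices of level one. -/
def coversStar {d : ℕ} (P F : Set (Fin d → ℝ)) (L : List (Set (Fin d → ℝ))) (i : ℕ) : Prop :=
  ∀ v ∈ vertexSet P, (v ∈ stSet P F ∨ HasLevel F v 1) → v ∈ seqS L i

/-- `ρ_1(F)`: the minimum of `Σ_{j=1}^{i_L} a_j` over all facet sequences `L` over `F(P)`
whose initial term is `F`, where `i_L` is the smallest index `i` such that `S_i` contains all
vertices of `st(F)` and all vertices of level one. -/
def rho1 {d : ℕ} (P F : Set (Fin d → ℝ)) : ℕ∞ :=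
  sInf {r | ∃ L i, IsSeqOver (facets P) L ∧ L.head? = some F ∧
    coversStar P F L i ∧ (∀ i' < i, ¬ coversStar P F L i') ∧
    r = ∑ j ∈ Finset.Icc 1 i, seqA (d : ℤ) L j}

/-- Eikelberg's space of affine dependences of one maximal cone, given by the scaled ray
generators `v'_i` and the index set `σ` of rays of the cone. -/
def ADsigma {d m : ℕ} (v' : Fin m → Fin d → ℚ) (σ : Finset (Fin m)) : Set (Fin m → ℚ) :=
  {a | (∀ i, i ∉ σ → a i = 0) ∧ (∑ i, a i • v' i) = 0 ∧ (∑ i, a i) = 0}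

/-- The total space of affine dependences: the sum (span of the union) of the subspaces
`AD(σ)` over all `σ` in the family `𝒞`. -/
def ADsum {d m : ℕ} (v' : Fin m → Fin d → ℚ) (𝒞 : Finset (Finset (Fin m))) :
    Submodule ℚ (Fin m → ℚ) :=
  Submodule.span ℚ (⋃ σ ∈ 𝒞, ADsigma v' σ)

/-- Two linear maps whose kernels meet a subspace in the same way have images of that subspace
of equal dimension. -/
theorem Submodule.finrank_map_eq_of_forall_mem_ker_iff {K V V₁ V₂ : Type*} [DivisionRing K]
    [AddCommGroup V] [Module K V] [AddCommGroup V₁] [Module K V₁] [AddCommGroup V₂] [Module K V₂]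
    [FiniteDimensional K V] (f : V →ₗ[K] V₁) (g : V →ₗ[K] V₂) (W : Submodule K V)
    (h : ∀ x ∈ W, f x = 0 ↔ g x = 0) :
    Module.finrank K (W.map f) = Module.finrank K (W.map g) := by
  have hker : LinearMap.ker (f.domRestrict W) = LinearMap.ker (g.domRestrict W) := by
    ext x
    simpa using h x x.2
  have hf := (f.domRestrict W).finrank_range_add_finrank_ker
  have hg := (g.domRestrict W).finrank_range_add_finrank_ker
  rw [LinearMap.range_domRestrict] at hf hg
  rw [hker] at hf
  omega

/-- Homogenization: the linear span of the points `(x, 1)`, `x ∈ s`, has dimension one more than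
the affine span of the nonempty set `s`. -/
theorem finrank_span_image_prodMk_one {K V : Type*} [DivisionRing K] [AddCommGroup V] [Module K V]
    [FiniteDimensional K V] {s : Set V} (hs : s.Nonempty) :
    Module.finrank K (Submodule.span K ((fun x => (x, (1 : K))) '' s)) =
      Module.finrank K (vectorSpan K s) + 1 := by
  obtain ⟨p, hp⟩ := hs
  have hspan : Submodule.span K ((fun x => (x, (1 : K))) '' s) =
      (vectorSpan K s).map (LinearMap.inl K V K) ⊔ Submodule.span K {(p, (1 : K))} := by
    apply le_antisymm
    · rw [Submodule.span_le]
      rintro _ ⟨x, hx, rfl⟩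
      refine Submodule.mem_sup.2 ⟨(x - p, 0), ⟨x - p, vsub_mem_vectorSpan K hx hp, rfl⟩,
        (p, 1), Submodule.mem_span_singleton_self _, ?_⟩
      simp
    · refine sup_le ?_ (Submodule.span_mono (by simpa using hp))
      rw [vectorSpan_eq_span_vsub_set_right K hp, Submodule.map_span, Submodule.span_le]
      rintro _ ⟨_, ⟨x, hx, rfl⟩, rfl⟩
      have hsub := Submodule.sub_mem _
        (Submodule.subset_span (R := K) (mem_image_of_mem (fun x => (x, (1 : K))) hx))
        (Submodule.subset_span (R := K) (mem_image_of_mem (fun x => (x, (1 : K))) hp))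
      simpa using hsub
  have hinf : (vectorSpan K s).map (LinearMap.inl K V K) ⊓ Submodule.span K {(p, (1 : K))} = ⊥ := by
    rw [eq_bot_iff]
    rintro _ ⟨⟨y, -, rfl⟩, hy⟩
    obtain ⟨c, hc⟩ := Submodule.mem_span_singleton.1 hy
    have hc0 : c = 0 := by simpa using congrArg Prod.snd hc
    simp [← hc, hc0]
  have hdim := Submodule.finrank_sup_add_finrank_inf_eq
    ((vectorSpan K s).map (LinearMap.inl K V K)) (Submodule.span K {(p, (1 : K))})
  rw [hinf, finrank_bot, add_zero, finrank_span_singleton (by simp),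
    ← (Submodule.equivMapOfInjective (LinearMap.inl K V K) LinearMap.inl_injective
      (vectorSpan K s)).finrank_eq] at hdim
  rw [hspan, hdim]

/-- The linear map sending coefficients `a` to the pair `(∑ aᵢ v'ᵢ, ∑ aᵢ)`, whose kernel is the
space of all affine dependences of the points `v'ᵢ`. -/
def affineDependenceMap {d m : ℕ} (v' : Fin m → Fin d → ℚ) :
    (Fin m → ℚ) →ₗ[ℚ] (Fin d → ℚ) × ℚ :=
  Fintype.linearCombination ℚ fun i => (v' i, (1 : ℚ))

theorem affineDependenceMap_apply {d m : ℕ} (v' : Fin m → Fin d → ℚ) (a : Fin m → ℚ) :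
    affineDependenceMap v' a = (∑ i, a i • v' i, ∑ i, a i) := by
  simp [affineDependenceMap, Fintype.linearCombination_apply, Prod.ext_iff, Prod.fst_sum,
    Prod.snd_sum]

theorem mem_ADsigma_iff {d m : ℕ} {v' : Fin m → Fin d → ℚ} {σ : Finset (Fin m)}
    {a : Fin m → ℚ} :
    a ∈ ADsigma v' σ ↔ (∀ i, i ∉ σ → a i = 0) ∧ affineDependenceMap v' a = 0 := by
  simp [ADsigma, affineDependenceMap_apply, Prod.ext_iff]

theorem ADsum_le_ker_affineDependenceMap {d m : ℕ} (v' : Fin m → Fin d → ℚ)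
    (𝒞 : Finset (Finset (Fin m))) :
    ADsum v' 𝒞 ≤ LinearMap.ker (affineDependenceMap v') := by
  refine Submodule.span_le.2 (iUnion₂_subset fun σ _ a ha => ?_)
  exact (mem_ADsigma_iff.1 ha).2

theorem mem_ADsum_iff_of_support_subset {d m : ℕ} {v' : Fin m → Fin d → ℚ}
    {𝒞 : Finset (Finset (Fin m))} {σ : Finset (Fin m)} (hσ : σ ∈ 𝒞) {a : Fin m → ℚ}
    (ha : ∀ i, i ∉ σ → a i = 0) :
    a ∈ ADsum v' 𝒞 ↔ affineDependenceMap v' a = 0 :=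
  ⟨fun h => ADsum_le_ker_affineDependenceMap v' 𝒞 h, fun h =>
    Submodule.subset_span (mem_iUnion₂.2 ⟨σ, hσ, mem_ADsigma_iff.2 ⟨ha, h⟩⟩)⟩

theorem apply_eq_zero_of_mem_span_single {ι K : Type*} [DecidableEq ι] [Semiring K] {T : Set ι}
    {a : ι → K} (ha : a ∈ Submodule.span K ((fun i => Pi.single i (1 : K)) '' T)) {i : ι}
    (hi : i ∉ T) : a i = 0 := by
  have hle : Submodule.span K ((fun i => Pi.single i (1 : K)) '' T) ≤
      LinearMap.ker (LinearMap.proj (R := K) (φ := fun _ : ι => K) i) := by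
    rw [Submodule.span_le]
    rintro _ ⟨j, hj, rfl⟩
    exact Pi.single_eq_of_ne (fun h : i = j => hi (h ▸ hj)) 1
  exact hle ha

/-- If `T` is a nonempty subset of some `σ ∈ 𝒞` and the points `{v'_i : i ∈ T}` span an
affine subspace of dimension `k'`, then the images of `{e_i : i ∈ T}` span a linear subspace
of `ℚ^m / AD` of dimension `k' + 1`. -/
theorem finrank_span_quotient_eq_affineDim_add_one
    {d m : ℕ} (v : Fin m → Fin d → ℚ) (l : Fin m → ℚ)
    (hv : ∀ i, v i ≠ 0) (hl : ∀ i, l i ≠ 0)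
    (v' : Fin m → Fin d → ℚ) (hv' : ∀ i, v' i = (l i)⁻¹ • v i)
    (𝒞 : Finset (Finset (Fin m))) (σ : Finset (Fin m)) (hσ : σ ∈ 𝒞)
    (T : Finset (Fin m)) (hT : T ⊆ σ) (hTne : T.Nonempty) (k' : ℕ)
    (hk : Module.finrank ℚ (affineSpan ℚ (v' '' (T : Set (Fin m)))).direction = k') :
    Module.finrank ℚ (Submodule.span ℚ
      ((fun i => (ADsum v' 𝒞).mkQ (Pi.single i (1 : ℚ))) '' (T : Set (Fin m)))) = k' + 1 := by
  have hquot : (fun i => (ADsum v' 𝒞).mkQ (Pi.single i (1 : ℚ))) '' (T : Set (Fin m)) =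
      (ADsum v' 𝒞).mkQ '' ((fun i => Pi.single i (1 : ℚ)) '' (T : Set (Fin m))) :=
    (image_image _ _ _).symm
  have hlift : affineDependenceMap v' '' ((fun i => Pi.single i (1 : ℚ)) '' (T : Set (Fin m))) =
      (fun x => (x, (1 : ℚ))) '' (v' '' (T : Set (Fin m))) := by
    simp only [image_image]
    exact image_congr fun i _ => by
      simp [affineDependenceMap, Fintype.linearCombination_apply_single]
  rw [hquot, ← Submodule.map_span,
    Submodule.finrank_map_eq_of_forall_mem_ker_iff _ (affineDependenceMap v') _ fun a ha => by
      rw [Submodule.mkQ_apply, Submodule.Quotient.mk_eq_zero]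
      exact mem_ADsum_iff_of_support_subset hσ fun i hi =>
        apply_eq_zero_of_mem_span_single ha fun hiT => hi (hT hiT),
    Submodule.map_span, hlift, finrank_span_image_prodMk_one (hTne.to_set.image v'),
    ← direction_affineSpan, hk]
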